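/- arXiv:2111.01181 — 7 statements merged into one kernel-verified Lean document; each statement's English description precedes it below -/
import Mathlib

section
/- Let (X, μ), Ω, γ and the sequence (M_ℓ)_{ℓ∈ℕ} of partitions be as in the context. Then the maximal measure of a refined cell tends to zero: lim_{ℓ→∞} sup_{K ∈ M_ℓ \ M_{ℓ+1}} μ(K) = 0, where the supremum over the empty set is interpreted as 0. -/
open MeasureTheory Filter
open scoped ENNReal

/-- If the members of a finite family are almost disjoint subsets of `K`, each of measure at most
`c * μ K`, then the sum of their squared measures is at most `c * μ K ^ 2`. -/
lemma sum_measure_sq_le {X : Type*} [MeasurableSpace X] {μ : Measure X} {K : Set X} {c : ℝ≥0∞}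
    (S : Finset (Set X)) (hmeas : ∀ A ∈ S, MeasurableSet A) (hsub : ∀ A ∈ S, A ⊆ K)
    (hdisj : ∀ A ∈ S, ∀ B ∈ S, A ≠ B → μ (A ∩ B) = 0) (hle : ∀ A ∈ S, μ A ≤ c * μ K) :
    ∑ A ∈ S, μ A ^ 2 ≤ c * μ K ^ 2 := by
  have hsum : ∑ A ∈ S, μ A ≤ μ K := by
    rw [← measure_biUnion_finset₀ (f := fun A => A) (fun A hA B hB hAB => hdisj A hA B hB hAB)
      fun A hA => (hmeas A hA).nullMeasurableSet]
    exact measure_mono (Set.iUnion₂_subset hsub)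
  calc ∑ A ∈ S, μ A ^ 2 ≤ ∑ A ∈ S, c * μ K * μ A := by
        refine Finset.sum_le_sum fun A hA => ?_
        rw [sq]
        gcongr
        exact hle A hA
    _ = c * μ K * ∑ A ∈ S, μ A := by rw [Finset.mul_sum]
    _ ≤ c * μ K * μ K := by gcongr
    _ = c * μ K ^ 2 := by ring

open scoped Classical in
/-- Refining a family of cells decreases the sum of the squared measures by at least `1 - γ` times
the contribution of the refined cells. -/
lemma sum_measure_sq_add_le_of_refinement {X : Type*} [MeasurableSpace X] {μ : Measure X}
    {γ : ℝ≥0∞} (hγ : γ ≤ 1) (M N : Finset (Set X)) (hmeas : ∀ A ∈ N, MeasurableSet A)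
    (hdisj : ∀ A ∈ N, ∀ B ∈ N, A ≠ B → μ (A ∩ B) = 0)
    (hnest : ∀ A ∈ N, ∃ K ∈ M, A ⊆ K)
    (hred : ∀ K ∈ M, K ∉ N → ∀ A ∈ N, A ⊆ K → μ A ≤ γ * μ K) :
    ∑ A ∈ N, μ A ^ 2 + ∑ K ∈ M \ N, (1 - γ) * μ K ^ 2 ≤ ∑ K ∈ M, μ K ^ 2 := by
  choose! p hpM hp using hnest
  have hfiber (K : Set X) (c : ℝ≥0∞) (hc : ∀ A ∈ N, A ⊆ K → μ A ≤ c * μ K) :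
      ∑ A ∈ N with p A = K, μ A ^ 2 ≤ c * μ K ^ 2 := by
    have hsub : ∀ A ∈ N.filter (p · = K), A ∈ N ∧ A ⊆ K := fun A hA => by
      obtain ⟨hAN, rfl⟩ := Finset.mem_filter.1 hA
      exact ⟨hAN, hp A hAN⟩
    exact sum_measure_sq_le _ (fun A hA => hmeas A (hsub A hA).1) (fun A hA => (hsub A hA).2)
      (fun A hA B hB => hdisj A (hsub A hA).1 B (hsub B hB).1)
      fun A hA => hc A (hsub A hA).1 (hsub A hA).2
  rw [← Finset.sum_fiberwise_of_maps_to hpM, Finset.sdiff_eq_filter, Finset.sum_filter,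
    ← Finset.sum_add_distrib]
  refine Finset.sum_le_sum fun K hKM => ?_
  split_ifs with hKN
  · simpa using hfiber K 1 fun A _ hA => by simpa using measure_mono hA
  · calc ∑ A ∈ N with p A = K, μ A ^ 2 + (1 - γ) * μ K ^ 2
        ≤ γ * μ K ^ 2 + (1 - γ) * μ K ^ 2 := by
          gcongr
          exact hfiber K γ (hred K hKM hKN)
      _ = μ K ^ 2 := by rw [← add_mul, add_tsub_cancel_of_le hγ, one_mul]

/-- A sequence of extended nonnegative reals bounded by the decrements of a sequence with finite
initial value tends to zero. -/
lemma ENNReal.tendsto_zero_of_add_le {P a : ℕ → ℝ≥0∞} (hP : P 0 ≠ ⊤)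
    (h : ∀ n, P (n + 1) + a n ≤ P n) : Tendsto a atTop (nhds 0) := by
  have hsum (n : ℕ) : P n + ∑ i ∈ Finset.range n, a i ≤ P 0 := by
    induction n with
    | zero => simp
    | succ n ih =>
      rw [Finset.sum_range_succ, add_comm _ (a n), ← add_assoc]
      exact (add_le_add_left (h n) _).trans ih
  refine ENNReal.tendsto_atTop_zero_of_tsum_ne_top (ne_top_of_le_ne_top hP ?_)
  rw [ENNReal.tsum_eq_iSup_nat]
  exact iSup_le fun n => le_add_self.trans (hsum n)

/-- Mesh-size reduction: the maximal measure of a refined cell tends to zero. -/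
theorem maximal_measure_of_refined_cells_tendsto_zero
    {X : Type*} [MeasurableSpace X] (μ : Measure X)
    (Ω : Set X) (hΩm : MeasurableSet Ω) (hΩ0 : 0 < μ Ω) (hΩfin : μ Ω < ⊤)
    (γ : ℝ≥0∞) (hγ0 : 0 < γ) (hγ1 : γ < 1)
    (M : ℕ → Finset (Set X))
    (hK : ∀ ℓ : ℕ, ∀ K ∈ M ℓ, MeasurableSet K ∧ K ⊆ Ω ∧ 0 < μ K ∧ μ K < ⊤)
    (hdisj : ∀ ℓ : ℕ, ∀ K ∈ M ℓ, ∀ K' ∈ M ℓ, K ≠ K' → μ (K ∩ K') = 0)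
    (hnest : ∀ ℓ : ℕ, ∀ K' ∈ M (ℓ + 1), ∃ K ∈ M ℓ, K' ⊆ K)
    (hred : ∀ ℓ : ℕ, ∀ K ∈ M ℓ, K ∉ M (ℓ + 1) →
      ∀ K' ∈ M (ℓ + 1), K' ⊆ K → μ K' ≤ γ * μ K) :
    Tendsto (fun ℓ : ℕ => ⨆ K ∈ ((M ℓ : Set (Set X)) \ (M (ℓ + 1) : Set (Set X))), μ K)
      atTop (nhds 0) := by
  classical
  have hlim := ENNReal.tendsto_zero_of_add_le
    (ENNReal.sum_ne_top.2 fun K hK0 => ENNReal.pow_ne_top (hK 0 K hK0).2.2.2.ne)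
    fun ℓ => sum_measure_sq_add_le_of_refinement hγ1.le (M ℓ) (M (ℓ + 1))
      (fun A hA => (hK (ℓ + 1) A hA).1) (hdisj (ℓ + 1)) (hnest ℓ) (hred ℓ)
  refine ENNReal.tendsto_nhds_zero.2 fun ε hε => ?_
  have hpos : 0 < (1 - γ) * ε ^ 2 :=
    ENNReal.mul_pos (tsub_pos_of_lt hγ1).ne' (pow_ne_zero 2 hε.ne')
  filter_upwards [hlim.eventually (gt_mem_nhds hpos)] with ℓ hℓ
  refine iSup₂_le fun K hKℓ => ?_
  by_contra! hlt
  refine hℓ.not_ge (le_trans ?_ (Finset.single_le_sum_of_canonicallyOrdered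
    (f := fun K => (1 - γ) * μ K ^ 2) (i := K) (by simpa using hKℓ)))
  gcongr
end

section
/- Let (X, μ), Ω, γ and the sequence (M_ℓ)_{ℓ∈ℕ} of partitions be as in the context. For j ∈ ℕ let M(j) denote the set of all measurable sets K such that K ∈ M_ℓ for some ℓ ∈ ℕ and γ^{j+1} μ(Ω) < μ(K) ≤ γ^j μ(Ω). Then any two distinct members of M(j) intersect in a μ-null set, and the cardinality of M(j) is strictly less than γ^{-(j+1)}. -/
open MeasureTheory Filter
open scoped ENNReal

/-- In a nested sequence of essentially disjoint families, a cell of a later level either equals a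
given earlier cell, is essentially disjoint from it, or is smaller by the factor `γ`. -/
theorem eq_or_measure_inter_eq_zero_or_measure_le_of_nested
    {X : Type*} [MeasurableSpace X] {μ : Measure X} {γ : ℝ≥0∞} {M : ℕ → Set (Set X)}
    (hdisj : ∀ ℓ : ℕ, ∀ K ∈ M ℓ, ∀ K' ∈ M ℓ, K ≠ K' → μ (K ∩ K') = 0)
    (hnest : ∀ ℓ : ℕ, ∀ K' ∈ M (ℓ + 1), ∃ K ∈ M ℓ, K' ⊆ K)
    (hred : ∀ ℓ : ℕ, ∀ K ∈ M ℓ, K ∉ M (ℓ + 1) →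
      ∀ K' ∈ M (ℓ + 1), K' ⊆ K → μ K' ≤ γ * μ K)
    {ℓ m : ℕ} (hm : ℓ ≤ m) {K : Set X} (hK : K ∈ M ℓ) {K' : Set X} (hK' : K' ∈ M m) :
    K = K' ∨ μ (K ∩ K') = 0 ∨ μ K' ≤ γ * μ K := by
  induction m, hm using Nat.le_induction generalizing K' with
  | base => exact or_iff_not_imp_left.2 fun h => Or.inl (hdisj ℓ K hK K' hK' h)
  | succ m hm ih =>
    obtain ⟨P, hP, hsub⟩ := hnest m K' hK'
    rcases ih hP with rfl | h | h
    · by_cases hmem : K ∈ M (m + 1)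
      · exact or_iff_not_imp_left.2 fun h => Or.inl (hdisj _ K hmem K' hK' h)
      · exact Or.inr (Or.inr (hred m K hP hmem K' hK' hsub))
    · exact Or.inr (Or.inl (measure_mono_null (Set.inter_subset_inter_right K hsub) h))
    · exact Or.inr (Or.inr ((measure_mono hsub).trans h))

/-- Fewer than `c⁻¹` pairwise essentially disjoint subsets of `Ω` have measure exceeding
`c * μ Ω`. -/
theorem finset_card_lt_inv_of_pairwise_aedisjoint
    {X : Type*} [MeasurableSpace X] {μ : Measure X} {Ω : Set X}
    {c : ℝ≥0∞} (hc : c ≠ ⊤) (F : Finset (Set X))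
    (hmeas : ∀ K ∈ F, MeasurableSet K) (hsub : ∀ K ∈ F, K ⊆ Ω)
    (hdisj : ∀ K ∈ F, ∀ K' ∈ F, K ≠ K' → μ (K ∩ K') = 0)
    (hlt : ∀ K ∈ F, c * μ Ω < μ K) :
    (F.card : ℝ≥0∞) < c⁻¹ := by
  rcases F.eq_empty_or_nonempty with rfl | hF
  · simpa [pos_iff_ne_zero] using hc
  have hsum : ∑ K ∈ F, μ K ≤ μ Ω := by
    rw [← measure_biUnion_finset₀ (fun K hK K' hK' h => hdisj K hK K' hK' h)
      fun K hK => (hmeas K hK).nullMeasurableSet]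
    exact measure_mono (Set.iUnion₂_subset hsub)
  have h : F.card * c * μ Ω < 1 * μ Ω := by
    calc F.card * c * μ Ω = ∑ _K ∈ F, c * μ Ω := by simp [mul_assoc]
      _ < ∑ K ∈ F, μ K := ENNReal.sum_lt_sum_of_nonempty hF hlt
      _ ≤ 1 * μ Ω := by rwa [one_mul]
  have h' : F.card * c < 1 := lt_of_mul_lt_mul_right' h
  rw [← one_div]
  exact (ENNReal.lt_div_iff_mul_lt (Or.inr (ENNReal.natCast_ne_top _)) (Or.inl hc)).2 h'

/-- The sets of cells (over all levels) whose measure lies in `(γ^(j+1) μ(Ω), γ^j μ(Ω)]`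
are pairwise essentially disjoint, and there are strictly fewer than `γ^{-(j+1)}` of them. -/
theorem card_of_cells_in_measure_band
    {X : Type*} [MeasurableSpace X] (μ : Measure X)
    (Ω : Set X) (hΩm : MeasurableSet Ω) (hΩ0 : 0 < μ Ω) (hΩfin : μ Ω < ⊤)
    (γ : ℝ≥0∞) (hγ0 : 0 < γ) (hγ1 : γ < 1)
    (M : ℕ → Finset (Set X))
    (hK : ∀ ℓ : ℕ, ∀ K ∈ M ℓ, MeasurableSet K ∧ K ⊆ Ω ∧ 0 < μ K ∧ μ K < ⊤)
    (hdisj : ∀ ℓ : ℕ, ∀ K ∈ M ℓ, ∀ K' ∈ M ℓ, K ≠ K' → μ (K ∩ K') = 0)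
    (hnest : ∀ ℓ : ℕ, ∀ K' ∈ M (ℓ + 1), ∃ K ∈ M ℓ, K' ⊆ K)
    (hred : ∀ ℓ : ℕ, ∀ K ∈ M ℓ, K ∉ M (ℓ + 1) →
      ∀ K' ∈ M (ℓ + 1), K' ⊆ K → μ K' ≤ γ * μ K)
    (j : ℕ) (S : Set (Set X))
    (hS : S = {K : Set X | (∃ ℓ : ℕ, K ∈ M ℓ) ∧
      γ ^ (j + 1) * μ Ω < μ K ∧ μ K ≤ γ ^ j * μ Ω}) :
    (∀ K ∈ S, ∀ K' ∈ S, K ≠ K' → μ (K ∩ K') = 0) ∧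
      S.Finite ∧ (S.ncard : ℝ≥0∞) < γ⁻¹ ^ (j + 1) := by
  have hnested := fun {ℓ m : ℕ} (hm : ℓ ≤ m) {K : Set X} (hK : K ∈ M ℓ) {K' : Set X}
      (hK' : K' ∈ M m) =>
    eq_or_measure_inter_eq_zero_or_measure_le_of_nested (μ := μ) (γ := γ)
      (M := fun ℓ => (M ℓ : Set (Set X))) hdisj hnest hred hm hK hK'
  have hband : ∀ K ∈ S, ∀ K' ∈ S, ¬ μ K' ≤ γ * μ K := by
    subst hS
    rintro K ⟨-, -, hle⟩ K' ⟨-, hlt, -⟩ h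
    refine (h.trans (mul_le_mul_right hle γ)).not_gt ?_
    rwa [← mul_assoc, ← pow_succ']
  have hlevel : ∀ K ∈ S, ∃ ℓ, K ∈ M ℓ := by
    subst hS
    exact fun K h => h.1
  have hpair : ∀ K ∈ S, ∀ K' ∈ S, K ≠ K' → μ (K ∩ K') = 0 := by
    intro K hKS K' hKS' hne
    obtain ⟨ℓ, hℓ⟩ := hlevel K hKS
    obtain ⟨m, hm⟩ := hlevel K' hKS'
    rcases le_total ℓ m with h | h
    · exact ((hnested h hℓ hm).resolve_left hne).resolve_right (hband K hKS K' hKS')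
    · rw [Set.inter_comm]
      exact ((hnested h hm hℓ).resolve_left hne.symm).resolve_right (hband K' hKS' K hKS)
  have hcard : ∀ F : Finset (Set X), (F : Set (Set X)) ⊆ S →
      (F.card : ℝ≥0∞) < γ⁻¹ ^ (j + 1) := by
    intro F hF
    rw [← ENNReal.inv_pow]
    refine finset_card_lt_inv_of_pairwise_aedisjoint (Ω := Ω)
      (ENNReal.pow_ne_top hγ1.ne_top) F
      (fun K h => ?_) (fun K h => ?_)
      (fun K h K' h' => hpair K (hF h) K' (hF h')) (fun K h => ?_)
    · obtain ⟨ℓ, hℓ⟩ := hlevel K (hF h)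
      exact (hK ℓ K hℓ).1
    · obtain ⟨ℓ, hℓ⟩ := hlevel K (hF h)
      exact (hK ℓ K hℓ).2.1
    · have hKS := hF h
      rw [hS] at hKS
      exact hKS.2.1
  have hfin : S.Finite := by
    by_contra hinf
    obtain ⟨n, hn⟩ := ENNReal.exists_nat_gt
      (ENNReal.pow_ne_top (n := j + 1) (ENNReal.inv_ne_top.2 hγ0.ne'))
    obtain ⟨F, hF, rfl⟩ := Set.Infinite.exists_subset_card_eq hinf n
    exact (hcard F hF).not_gt hn
  refine ⟨hpair, hfin, ?_⟩
  rw [Set.ncard_eq_toFinset_card S hfin]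
  exact hcard _ (by simp)
end

section
/- Let E be a finite-dimensional real inner product space, 1 < p < ∞ with conjugate exponent p' = p/(p−1), and let W : E → ℝ be a convex differentiable function satisfying the two-sided growth c₁‖A‖^p − c₂ ≤ W(A) ≤ c₃‖A‖^p + c₄ for all A ∈ E, with constants c₁, c₃ > 0 and c₂, c₄ ≥ 0. Then there exist constants c₅, c₆ ≥ 0 such that ‖∇W(A)‖^{p'} ≤ c₅‖A‖^p + c₆ for all A ∈ E. -/
open scoped RealInnerProductSpace

/-- The gradient of a convex differentiable function is a subgradient. -/
theorem ConvexOn.add_inner_gradient_le {E : Type*} [NormedAddCommGroup E] [InnerProductSpace ℝ E]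
    [CompleteSpace E] {W : E → ℝ} (hW : ConvexOn ℝ Set.univ W) {A : E}
    (hd : DifferentiableAt ℝ W A) (v : E) :
    W A + ⟪gradient W A, v⟫ ≤ W (A + v) := by
  have hconv : ConvexOn ℝ Set.univ (fun t : ℝ => W (AffineMap.lineMap A (A + v) t)) :=
    hW.comp_affineMap (AffineMap.lineMap A (A + v))
  have hderiv : HasDerivAt (fun t : ℝ => W (AffineMap.lineMap A (A + v) t))
      ⟪gradient W A, v⟫ 0 := by
    have hline : HasDerivAt (AffineMap.lineMap A (A + v) : ℝ → E) v 0 := by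
      simpa using (AffineMap.hasDerivAt_lineMap (a := A) (b := A + v) (x := (0 : ℝ)))
    have hgrad : HasFDerivAt W (InnerProductSpace.toDual ℝ E (gradient W A))
        (AffineMap.lineMap A (A + v) (0 : ℝ)) := by
      simpa using hd.hasGradientAt.hasFDerivAt
    exact hgrad.comp_hasDerivAt (0 : ℝ) hline
  have hslope := hconv.le_slope_of_hasDerivAt (Set.mem_univ 0) (Set.mem_univ 1) one_pos hderiv
  simp only [slope_def_field, AffineMap.lineMap_apply_one, AffineMap.lineMap_apply_zero, sub_zero,
    div_one] at hslope
  linarith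

/-- Two-sided `p`-growth of a convex `C¹` energy density implies `p'`-growth of its gradient. -/
theorem gradient_growth_of_two_sided_growth
    {E : Type*} [NormedAddCommGroup E] [InnerProductSpace ℝ E] [FiniteDimensional ℝ E]
    (p : ℝ) (hp : 1 < p)
    (W : E → ℝ) (hWconv : ConvexOn ℝ Set.univ W) (hWdiff : Differentiable ℝ W)
    (c₁ c₂ c₃ c₄ : ℝ) (hc₁ : 0 < c₁) (hc₂ : 0 ≤ c₂) (hc₃ : 0 < c₃) (hc₄ : 0 ≤ c₄)
    (hgrowth : ∀ A : E, c₁ * ‖A‖ ^ p - c₂ ≤ W A ∧ W A ≤ c₃ * ‖A‖ ^ p + c₄) :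
    ∃ c₅ c₆ : ℝ, 0 ≤ c₅ ∧ 0 ≤ c₆ ∧
      ∀ A : E, ‖gradient W A‖ ^ (p / (p - 1)) ≤ c₅ * ‖A‖ ^ p + c₆ := by
  have hp₁ : 0 < p - 1 := sub_pos.2 hp
  have hp₀ : 0 < p := one_pos.trans hp
  set K : ℝ := c₃ * 2 ^ p + c₄ + c₂ with hK
  have hK₀ : 0 ≤ K := by positivity
  set C : ℝ := K ^ (p / (p - 1))
  have hC₀ : 0 ≤ C := by positivity
  refine ⟨C, C, hC₀, hC₀, fun A => ?_⟩
  set G := gradient W A with hG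
  set r : ℝ := max ‖A‖ 1 with hr
  have hAr : ‖A‖ ≤ r := le_max_left _ _
  have hr₁ : 1 ≤ r := le_max_right _ _
  have hr₀ : 0 < r := by linarith
  have hrp : 1 ≤ r ^ p := Real.one_le_rpow hr₁ hp₀.le
  -- Test the subgradient inequality at distance at most `r` in the direction of the gradient.
  have hbound : r * ‖G‖ ≤ K * r ^ p := by
    have hsub := hWconv.add_inner_gradient_le (hWdiff A) ((r * ‖G‖⁻¹) • G)
    have hinner : ⟪G, (r * ‖G‖⁻¹) • G⟫ = r * ‖G‖ := by
      rw [real_inner_smul_right, real_inner_self_eq_norm_sq]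
      rcases eq_or_ne ‖G‖ 0 with h | h
      · simp [h]
      · field_simp
    have hnorm : ‖A + (r * ‖G‖⁻¹) • G‖ ≤ 2 * r := by
      have hstep : ‖(r * ‖G‖⁻¹) • G‖ ≤ r := by
        rw [norm_smul, Real.norm_of_nonneg (by positivity), mul_assoc]
        exact mul_le_of_le_one_right hr₀.le inv_mul_le_one
      linarith [norm_add_le A ((r * ‖G‖⁻¹) • G)]
    have hpow : ‖A + (r * ‖G‖⁻¹) • G‖ ^ p ≤ 2 ^ p * r ^ p := by
      rw [← Real.mul_rpow zero_le_two hr₀.le]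
      exact Real.rpow_le_rpow (norm_nonneg _) hnorm hp₀.le
    have hlow : -c₂ ≤ W A := by
      have : 0 ≤ c₁ * ‖A‖ ^ p := by positivity
      linarith [(hgrowth A).1]
    rw [← hG, hinner] at hsub
    have hup := (hgrowth (A + (r * ‖G‖⁻¹) • G)).2
    have := mul_le_mul_of_nonneg_left hpow hc₃.le
    have := mul_le_mul_of_nonneg_left hrp (add_nonneg hc₄ hc₂)
    rw [hK]
    linarith
  have hgrad : ‖G‖ ≤ K * r ^ (p - 1) := by
    rw [Real.rpow_sub_one hr₀.ne', ← mul_div_assoc, le_div_iff₀ hr₀]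
    linarith
  calc ‖G‖ ^ (p / (p - 1)) ≤ (K * r ^ (p - 1)) ^ (p / (p - 1)) :=
        Real.rpow_le_rpow (norm_nonneg _) hgrad (by positivity)
    _ = K ^ (p / (p - 1)) * r ^ p := by
        rw [Real.mul_rpow hK₀ (by positivity), ← Real.rpow_mul hr₀.le,
          mul_div_cancel₀ _ hp₁.ne']
    _ ≤ C * (‖A‖ ^ p + 1) := by
        refine mul_le_mul_of_nonneg_left ?_ hC₀
        rcases max_choice ‖A‖ 1 with h | h
        · rw [hr, h]
          linarith
        · rw [hr, h, Real.one_rpow]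
          linarith [Real.rpow_nonneg (norm_nonneg A) p]
    _ = C * ‖A‖ ^ p + C := by ring
end

section
/- There exists a constant C > 0, depending only on ξ₁, ξ₂, μ₁, μ₂, such that the optimal-design energy density satisfies the stress control |∇W(a) − ∇W(b)|² ≤ C (W(a) − W(b) − ∇W(b)·(a − b)) for all a, b ∈ ℝⁿ. -/
open scoped RealInnerProductSpace

section RadialConvexity

variable {E : Type*} [NormedAddCommGroup E] [InnerProductSpace ℝ E]

/-- A gradient coincides with any global subgradient at the same point. -/
theorem HasGradientAt.eq_of_subgradient [CompleteSpace E] {F : E → ℝ} {x v q : E}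
    (h : HasGradientAt F v x) (hq : ∀ y, F x + ⟪q, y - x⟫ ≤ F y) : v = q := by
  have hmin : IsLocalMin (fun y => F y - ⟪q, y⟫) x := by
    refine Filter.Eventually.of_forall fun y => ?_
    have := hq y
    rw [inner_sub_right] at this
    show F x - ⟪q, x⟫ ≤ F y - ⟪q, y⟫
    linarith
  have hd := h.hasFDerivAt.sub ((innerSL ℝ q).hasFDerivAt (x := x))
  have h0 := hmin.hasFDerivAt_eq_zero hd
  refine ext_inner_right ℝ fun w => ?_
  have := DFunLike.congr_fun h0 w
  simpa [sub_eq_zero] using this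

/-- First-order convexity inequality for a radial function whose profile has a nonnegative
subgradient at every point of the half-line. -/
theorem HasGradientAt.add_inner_le_of_radial [CompleteSpace E] {f : ℝ → ℝ}
    (hf : ∀ s, 0 ≤ s → ∃ p, 0 ≤ p ∧ ∀ t, 0 ≤ t → f s + p * (t - s) ≤ f t)
    {F : E → ℝ} (hF : ∀ x, F x = f ‖x‖) {x v : E} (h : HasGradientAt F v x) (y : E) :
    F x + ⟪v, y - x⟫ ≤ F y := by
  obtain ⟨p, hp, hpt⟩ := hf ‖x‖ (norm_nonneg x)
  have key : ∀ y, F x + ⟪(p * ‖x‖⁻¹) • x, y - x⟫ ≤ F y := by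
    intro y
    have h1 := hpt ‖y‖ (norm_nonneg y)
    rw [hF, hF]
    refine le_trans ?_ h1
    rw [real_inner_smul_left, inner_sub_right, real_inner_self_eq_norm_sq, mul_assoc]
    gcongr
    rcases eq_or_ne x 0 with rfl | hx
    · simp
    · have hx' : 0 < ‖x‖ := norm_pos_iff.mpr hx
      rw [inv_mul_le_iff₀ hx']
      nlinarith [real_inner_le_norm x y]
  rw [h.eq_of_subgradient key]
  exact key y

/-- Cocoercivity: if `F` is convex and `L / 2 * ‖·‖ ^ 2 - F` is convex, both to first order, then
gradient differences are controlled by the Bregman distance of `F`. -/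
theorem norm_sub_sq_le_of_bregman_bounds {F : E → ℝ} {G : E → E} {L : ℝ} (hL : 0 < L)
    (hlow : ∀ x y, F x + ⟪G x, y - x⟫ ≤ F y)
    (hup : ∀ x y, (L / 2 * ‖x‖ ^ 2 - F x) + ⟪L • x - G x, y - x⟫ ≤ L / 2 * ‖y‖ ^ 2 - F y)
    (a b : E) : ‖G a - G b‖ ^ 2 ≤ 2 * L * (F a - F b - ⟪G b, a - b⟫) := by
  set d := G a - G b with hd
  have h1 := hlow b (a - L⁻¹ • d)
  have h2 := hup a (a - L⁻¹ • d)
  have e1 : ⟪G b, a - L⁻¹ • d - b⟫ = ⟪G b, a - b⟫ - L⁻¹ * ⟪G b, d⟫ := by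
    rw [sub_right_comm, inner_sub_right _ (a - b), real_inner_smul_right]
  have e2 : ⟪L • a - G a, a - L⁻¹ • d - a⟫ = L⁻¹ * ⟪G a, d⟫ - ⟪a, d⟫ := by
    rw [sub_sub_cancel_left, inner_neg_right, real_inner_smul_right, inner_sub_left,
      real_inner_smul_left]
    field_simp
    ring
  have e3 : ‖a - L⁻¹ • d‖ ^ 2 = ‖a‖ ^ 2 - 2 * L⁻¹ * ⟪a, d⟫ + L⁻¹ ^ 2 * ‖d‖ ^ 2 := by
    rw [norm_sub_sq_real, real_inner_smul_right, norm_smul, mul_pow, Real.norm_eq_abs, sq_abs]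
    ring
  have e4 : ⟪G a, d⟫ = ⟪G b, d⟫ + ‖d‖ ^ 2 := by
    rw [← real_inner_self_eq_norm_sq, ← inner_add_left, hd, add_sub_cancel]
  rw [e1] at h1
  rw [e2, e3, e4] at h2
  have h3 : L⁻¹ / 2 * ‖d‖ ^ 2 ≤ F a - F b - ⟪G b, a - b⟫ := by
    have : L / 2 * (‖a‖ ^ 2 - 2 * L⁻¹ * ⟪a, d⟫ + L⁻¹ ^ 2 * ‖d‖ ^ 2)
        = L / 2 * ‖a‖ ^ 2 - ⟪a, d⟫ + L⁻¹ / 2 * ‖d‖ ^ 2 := by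
      field_simp
    rw [this] at h2
    linarith
  calc ‖d‖ ^ 2 = 2 * L * (L⁻¹ / 2 * ‖d‖ ^ 2) := by field_simp
    _ ≤ _ := by gcongr

end RadialConvexity

/-- Stress convexity control for the optimal-design energy density. -/
theorem optimalDesign_stress_control
    (n : ℕ) (hn : 1 ≤ n) (ξ₁ ξ₂ μ₁ μ₂ : ℝ)
    (hξ₁ : 0 < ξ₁) (hξ : ξ₁ < ξ₂) (hμ₁ : 0 < μ₁) (hμ : μ₁ < μ₂)
    (hcompat : ξ₁ * μ₂ = ξ₂ * μ₁)
    (ψ : ℝ → ℝ)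
    (hψ₁ : ∀ t : ℝ, 0 ≤ t → t ≤ ξ₁ → ψ t = μ₂ * t ^ 2 / 2)
    (hψ₂ : ∀ t : ℝ, ξ₁ ≤ t → t ≤ ξ₂ → ψ t = ξ₁ * μ₂ * (t - ξ₁ / 2))
    (hψ₃ : ∀ t : ℝ, ξ₂ ≤ t → ψ t = μ₁ * t ^ 2 / 2 - ξ₁ * μ₂ * (ξ₁ / 2 - ξ₂ / 2))
    (W : EuclideanSpace ℝ (Fin n) → ℝ) (hW : ∀ a, W a = ψ ‖a‖)
    (hWdiff : Differentiable ℝ W) :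
    ∃ C : ℝ, 0 < C ∧ ∀ a b : EuclideanSpace ℝ (Fin n),
      ‖gradient W a - gradient W b‖ ^ 2 ≤
        C * (W a - W b - ⟪gradient W b, a - b⟫) := by
  have hμ₂ : 0 < μ₂ := hμ₁.trans hμ
  have hgrad : ∀ x, HasGradientAt W (gradient W x) x := fun x => (hWdiff x).hasGradientAt
  obtain ⟨m, hm, rfl, rfl⟩ : ∃ m, 0 < m ∧ μ₁ = m * ξ₁ ∧ μ₂ = m * ξ₂ := by
    refine ⟨μ₁ / ξ₁, by positivity, by field_simp, ?_⟩
    field_simp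
    linarith
  have hξ₂ : 0 < ξ₂ := hξ₁.trans hξ
  have hξ' : 0 < ξ₂ - ξ₁ := sub_pos.2 hξ
  have hregion : ∀ t, 0 ≤ t →
      (t ≤ ξ₁ ∧ ψ t = m * ξ₂ * t ^ 2 / 2) ∨
      (ξ₁ ≤ t ∧ t ≤ ξ₂ ∧ ψ t = m * (ξ₁ * ξ₂ * (t - ξ₁ / 2))) ∨
      (ξ₂ ≤ t ∧ ψ t = m * (ξ₁ * t ^ 2 / 2 - ξ₁ * ξ₂ * (ξ₁ / 2 - ξ₂ / 2))) := by
    intro t ht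
    rcases le_total t ξ₁ with h | h
    · exact Or.inl ⟨h, hψ₁ t ht h⟩
    rcases le_total t ξ₂ with h' | h'
    · exact Or.inr (Or.inl ⟨h, h', by rw [hψ₂ t h h']; ring⟩)
    · exact Or.inr (Or.inr ⟨h', by rw [hψ₃ t h']; ring⟩)
  have hψsub : ∀ s, 0 ≤ s → ∃ p, 0 ≤ p ∧ ∀ t, 0 ≤ t → ψ s + p * (t - s) ≤ ψ t := by
    intro s hs
    rcases hregion s hs with ⟨h, e⟩ | ⟨h, h', e⟩ | ⟨h, e⟩ <;> rw [← sub_nonneg] at h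
    · refine ⟨m * (ξ₂ * s), by positivity, fun t ht => ?_⟩
      rw [e]
      rcases hregion t ht with ⟨k, e'⟩ | ⟨k, k', e'⟩ | ⟨k, e'⟩ <;> rw [e', ← sub_nonneg] <;>
        rw [← sub_nonneg] at k
      · have : 0 ≤ m * (ξ₂ * (t - s) ^ 2) := by positivity
        linarith
      · rw [← sub_nonneg] at k'
        have : 0 ≤ m * (ξ₂ * ((ξ₁ - s) * (2 * (t - ξ₁) + (ξ₁ - s)))) := by positivity
        linarith
      · have : 0 ≤
            m * (ξ₁ * (t - ξ₂) ^ 2 + ξ₂ * (ξ₁ - s) * (2 * (t - ξ₂) + 2 * (ξ₂ - ξ₁) + (ξ₁ - s))) := by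
          positivity
        linarith
    · rw [← sub_nonneg] at h'
      refine ⟨m * (ξ₁ * ξ₂), by positivity, fun t ht => ?_⟩
      rw [e]
      rcases hregion t ht with ⟨k, e'⟩ | ⟨k, k', e'⟩ | ⟨k, e'⟩ <;> rw [e', ← sub_nonneg] <;>
        rw [← sub_nonneg] at k
      · have : 0 ≤ m * (ξ₂ * (t - ξ₁) ^ 2) := by positivity
        linarith
      · exact le_of_eq (by ring)
      · have : 0 ≤ m * (ξ₁ * (t - ξ₂) ^ 2) := by positivity
        linarith
    · refine ⟨m * (ξ₁ * s), by positivity, fun t ht => ?_⟩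
      rw [e]
      rcases hregion t ht with ⟨k, e'⟩ | ⟨k, k', e'⟩ | ⟨k, e'⟩ <;> rw [e', ← sub_nonneg] <;>
        rw [← sub_nonneg] at k
      · have : 0 ≤
            m * (ξ₂ * (t - ξ₁) ^ 2 + ξ₁ * (s - ξ₂) * ((s - ξ₂) + 2 * (ξ₂ - ξ₁) + 2 * (ξ₁ - t))) := by
          positivity
        linarith
      · rw [← sub_nonneg] at k'
        have : 0 ≤ m * (ξ₁ * (s - ξ₂) * ((s - ξ₂) + 2 * (ξ₂ - t))) := by positivity
        linarith
      · have : 0 ≤ m * (ξ₁ * (t - s) ^ 2) := by positivity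
        linarith
  have hgsub : ∀ s, 0 ≤ s → ∃ p, 0 ≤ p ∧ ∀ t, 0 ≤ t →
      (m * ξ₂ / 2 * s ^ 2 - ψ s) + p * (t - s) ≤ m * ξ₂ / 2 * t ^ 2 - ψ t := by
    intro s hs
    rcases hregion s hs with ⟨h, e⟩ | ⟨h, h', e⟩ | ⟨h, e⟩ <;> rw [← sub_nonneg] at h
    · refine ⟨0, le_rfl, fun t ht => ?_⟩
      rw [e]
      rcases hregion t ht with ⟨k, e'⟩ | ⟨k, k', e'⟩ | ⟨k, e'⟩ <;> rw [e', ← sub_nonneg] <;>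
        rw [← sub_nonneg] at k
      · exact le_of_eq (by ring)
      · rw [← sub_nonneg] at k'
        have : 0 ≤ m * (ξ₂ * (t - ξ₁) ^ 2) := by positivity
        linarith
      · have : 0 ≤ m * ((ξ₂ - ξ₁) * ((t - ξ₂) * (t + ξ₂) + ξ₂ * (ξ₂ - ξ₁))) := by positivity
        linarith
    · rw [← sub_nonneg] at h'
      refine ⟨m * (ξ₂ * (s - ξ₁)), by positivity, fun t ht => ?_⟩
      rw [e]
      rcases hregion t ht with ⟨k, e'⟩ | ⟨k, k', e'⟩ | ⟨k, e'⟩ <;> rw [e', ← sub_nonneg] <;>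
        rw [← sub_nonneg] at k
      · have : 0 ≤ m * (ξ₂ * (s - ξ₁) * ((s - ξ₁) + 2 * (ξ₁ - t))) := by positivity
        linarith
      · rw [← sub_nonneg] at k'
        have : 0 ≤ m * (ξ₂ * (t - s) ^ 2) := by positivity
        linarith
      · have : 0 ≤ m * ((ξ₂ - ξ₁) * (t - ξ₂) ^ 2 + ξ₂ * (ξ₂ - s) * (2 * (t - ξ₂) + (ξ₂ - s))) := by
          positivity
        linarith
    · refine ⟨m * ((ξ₂ - ξ₁) * s), by positivity, fun t ht => ?_⟩
      rw [e]
      rcases hregion t ht with ⟨k, e'⟩ | ⟨k, k', e'⟩ | ⟨k, e'⟩ <;> rw [e', ← sub_nonneg] <;>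
        rw [← sub_nonneg] at k
      · have : 0 ≤ m * ((ξ₂ - ξ₁) * ((s - ξ₁) ^ 2 + ξ₁ * (ξ₂ - ξ₁) + 2 * s * (ξ₁ - t))) := by
          positivity
        linarith
      · rw [← sub_nonneg] at k'
        have : 0 ≤ m * (ξ₂ * (t - ξ₂) ^ 2 + (ξ₂ - ξ₁) * (s - ξ₂) * ((s - ξ₂) + 2 * (ξ₂ - t))) := by
          positivity
        linarith
      · have : 0 ≤ m * ((ξ₂ - ξ₁) * (t - s) ^ 2) := by positivity
        linarith
  refine ⟨2 * (m * ξ₂), by positivity, norm_sub_sq_le_of_bregman_bounds hμ₂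
    (fun x y => (hgrad x).add_inner_le_of_radial hψsub hW y) fun x y => ?_⟩
  have hg : HasGradientAt (fun z => m * ξ₂ / 2 * ‖z‖ ^ 2 - W z)
      ((m * ξ₂) • x - gradient W x) x := by
    rw [hasGradientAt_iff_hasFDerivAt]
    refine (((hasStrictFDerivAt_norm_sq x).hasFDerivAt.const_mul (m * ξ₂ / 2)).sub
      (hgrad x).hasFDerivAt).congr_fderiv ?_
    ext w
    simp
    ring
  exact hg.add_inner_le_of_radial (f := fun t => m * ξ₂ / 2 * t ^ 2 - ψ t) hgsub
    (fun z => by simp only [hW]) y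
end

section
/- The relaxed two-well energy density W is a convex function on ℝⁿ. -/
open scoped RealInnerProductSpace

theorem convexOn_norm_sq_mul_sub_inner_sq {E : Type*} [NormedAddCommGroup E]
    [InnerProductSpace ℝ E] (a : E) :
    ConvexOn ℝ Set.univ fun v : E => ‖a‖ ^ 2 * ‖v‖ ^ 2 - ⟪a, v⟫ ^ 2 := by
  refine ⟨convex_univ, fun x _ y _ s t hs ht hst => ?_⟩
  have cauchy_schwarz : ⟪a, x - y⟫ ^ 2 ≤ ‖a‖ ^ 2 * ‖x - y‖ ^ 2 := by
    rw [← mul_pow, sq_le_sq, abs_of_nonneg (by positivity : 0 ≤ ‖a‖ * ‖x - y‖)]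
    exact abs_real_inner_le_norm a (x - y)
  have key := mul_nonneg (mul_nonneg hs ht) (sub_nonneg.2 cauchy_schwarz)
  rw [norm_sub_sq_real, inner_sub_right] at key
  obtain rfl : t = 1 - s := by linarith
  simp only [smul_eq_mul, norm_add_sq_real, inner_add_right, real_inner_smul_left,
    real_inner_smul_right, norm_smul, mul_pow, Real.norm_eq_abs, sq_abs]
  linarith

theorem convexOn_max_norm_sq_sub_sq {E : Type*} [SeminormedAddCommGroup E] [NormedSpace ℝ E]
    (c : ℝ) : ConvexOn ℝ Set.univ fun v : E => max 0 (‖v‖ ^ 2 - c) ^ 2 := by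
  have norm_sq : ConvexOn ℝ Set.univ fun v : E => ‖v‖ ^ 2 :=
    convexOn_univ_norm.pow (fun _ _ => norm_nonneg _) 2
  exact ((convexOn_const (0 : ℝ) convex_univ).sup (norm_sq.sub (concaveOn_const c convex_univ))).pow
    (fun _ _ => le_max_left _ _) 2

/-- The relaxed two-well energy density is convex. -/
theorem twoWell_convex
    (n : ℕ) (hn : 1 ≤ n) (F₁ F₂ : EuclideanSpace ℝ (Fin n)) (hF : F₁ ≠ F₂)
    (A B : EuclideanSpace ℝ (Fin n))
    (hA : A = (1 / 2 : ℝ) • (F₂ - F₁)) (hB : B = (1 / 2 : ℝ) • (F₁ + F₂))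
    (W : EuclideanSpace ℝ (Fin n) → ℝ)
    (hW : ∀ F, W F = max 0 (‖F - B‖ ^ 2 - ‖A‖ ^ 2) ^ 2 +
      4 * (‖A‖ ^ 2 * ‖F - B‖ ^ 2 - ⟪A, F - B⟫ ^ 2)) :
    ConvexOn ℝ Set.univ W := by
  have centered := (convexOn_max_norm_sq_sub_sq (E := EuclideanSpace ℝ (Fin n)) (‖A‖ ^ 2)).add
    ((convexOn_norm_sq_mul_sub_inner_sq A).smul (by norm_num : (0 : ℝ) ≤ 4))
  have translated := centered.translate_left (-B)
  rw [Set.preimage_univ] at translated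
  refine translated.congr fun F _ => ?_
  simp [hW, sub_eq_add_neg]
end

section
/- There exists a constant C > 0 (depending on F₁ and F₂) such that the relaxed two-well energy density satisfies the stress control |∇W(F) − ∇W(G)|² ≤ C (1 + |F|² + |G|²)(W(F) − W(G) − ∇W(G)·(F − G)) for all F, G ∈ ℝⁿ. -/
open scoped RealInnerProductSpace

lemma hasDerivAt_max_zero_sq (r : ℝ) :
    HasDerivAt (fun r : ℝ => max 0 r ^ 2) (2 * max 0 r) r := by
  rw [hasDerivAt_iff_isLittleO]
  refine Asymptotics.IsBigO.trans_isLittleO (g := fun r' => (r' - r) ^ 2) ?_ ?_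
  · refine Asymptotics.IsBigO.of_bound 1 (Filter.Eventually.of_forall fun r' => ?_)
    rw [one_mul, Real.norm_eq_abs, Real.norm_eq_abs, abs_sq, abs_le, smul_eq_mul]
    rcases max_cases 0 r with ⟨h, h'⟩ | ⟨h, h'⟩ <;> rcases max_cases 0 r' with ⟨k, k'⟩ | ⟨k, k'⟩ <;>
      rw [h, k] <;> constructor <;> nlinarith
  · have h := (Asymptotics.isLittleO_pow_id (𝕜 := ℝ) one_lt_two).comp_tendsto
      (show Filter.Tendsto (fun r' : ℝ => r' - r) (nhds r) (nhds 0) from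
        (by fun_prop : Continuous fun r' : ℝ => r' - r).tendsto' r 0 (sub_self r))
    exact h

section
variable {E : Type*} [NormedAddCommGroup E] [InnerProductSpace ℝ E]

lemma hasGradientAt_twoWell [CompleteSpace E] (A B F : E) :
    HasGradientAt (fun F : E => max 0 (‖F - B‖ ^ 2 - ‖A‖ ^ 2) ^ 2 +
      4 * (‖A‖ ^ 2 * ‖F - B‖ ^ 2 - ⟪A, F - B⟫ ^ 2))
      ((4 * max 0 (‖F - B‖ ^ 2 - ‖A‖ ^ 2)) • (F - B) +
        (8 : ℝ) • (‖A‖ ^ 2 • (F - B) - ⟪A, F - B⟫ • A)) F := by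
  rw [hasGradientAt_iff_hasFDerivAt]
  have hx : HasFDerivAt (fun F : E => F - B) (ContinuousLinearMap.id ℝ E) F :=
    (hasFDerivAt_id F).sub_const B
  have hN := hx.norm_sq
  have hI := (innerSL ℝ A).hasFDerivAt.comp F hx
  have h := ((hasDerivAt_max_zero_sq _).comp_hasFDerivAt F (hN.sub_const (‖A‖ ^ 2))).add
    (((hN.const_mul (‖A‖ ^ 2)).sub (hI.pow 2)).const_mul 4)
  refine h.congr_fderiv ?_
  ext v
  simp
  ring

/-- The stress control, with `x`, `y` the arguments measured from the midpoint of the wells. -/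
lemma twoWell_stress_sq_le (A x y : E) :
    ‖((4 * max 0 (‖x‖ ^ 2 - ‖A‖ ^ 2)) • x + (8 : ℝ) • (‖A‖ ^ 2 • x - ⟪A, x⟫ • A)) -
      ((4 * max 0 (‖y‖ ^ 2 - ‖A‖ ^ 2)) • y + (8 : ℝ) • (‖A‖ ^ 2 • y - ⟪A, y⟫ • A))‖ ^ 2 ≤
    48 * (‖x‖ ^ 2 + ‖y‖ ^ 2 + ‖A‖ ^ 2) *
      ((max 0 (‖x‖ ^ 2 - ‖A‖ ^ 2) ^ 2 + 4 * (‖A‖ ^ 2 * ‖x‖ ^ 2 - ⟪A, x⟫ ^ 2)) -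
        (max 0 (‖y‖ ^ 2 - ‖A‖ ^ 2) ^ 2 + 4 * (‖A‖ ^ 2 * ‖y‖ ^ 2 - ⟪A, y⟫ ^ 2)) -
        ⟪(4 * max 0 (‖y‖ ^ 2 - ‖A‖ ^ 2)) • y + (8 : ℝ) • (‖A‖ ^ 2 • y - ⟪A, y⟫ • A), x - y⟫) := by
  obtain ⟨u, rfl⟩ : ∃ u, x = y + u := ⟨x - y, by abel⟩
  set s := max 0 (‖y + u‖ ^ 2 - ‖A‖ ^ 2) with hs
  set t := max 0 (‖y‖ ^ 2 - ‖A‖ ^ 2) with ht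
  have hs' : ‖y + u‖ ^ 2 - ‖A‖ ^ 2 ≤ s := le_max_right _ _
  have ht0 : 0 ≤ t := le_max_left _ _
  have hty : t ≤ ‖y‖ ^ 2 := max_le (sq_nonneg _) (by linarith [sq_nonneg ‖A‖])
  have htt : t * (t - (‖y‖ ^ 2 - ‖A‖ ^ 2)) = 0 := by
    rcases max_choice 0 (‖y‖ ^ 2 - ‖A‖ ^ 2) with h | h <;> rw [ht, h] <;> ring
  have hxn : ‖y + u‖ ^ 2 = ‖y‖ ^ 2 + 2 * ⟪y, u⟫ + ‖u‖ ^ 2 := norm_add_sq_real y u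
  have hQ : 0 ≤ ‖A‖ ^ 2 * ‖u‖ ^ 2 - ⟪A, u⟫ ^ 2 := by
    have h := real_inner_mul_inner_self_le A u
    rw [real_inner_self_eq_norm_sq, real_inner_self_eq_norm_sq] at h
    nlinarith
  set D := (s ^ 2 + 4 * (‖A‖ ^ 2 * ‖y + u‖ ^ 2 - ⟪A, y + u⟫ ^ 2)) -
        (t ^ 2 + 4 * (‖A‖ ^ 2 * ‖y‖ ^ 2 - ⟪A, y⟫ ^ 2)) -
        ⟪(4 * t) • y + (8 : ℝ) • (‖A‖ ^ 2 • y - ⟪A, y⟫ • A), y + u - y⟫ with hD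
  have hbreg : (s - t) ^ 2 + 2 * (t * ‖u‖ ^ 2) + 4 * (‖A‖ ^ 2 * ‖u‖ ^ 2 - ⟪A, u⟫ ^ 2) ≤ D := by
    rw [hD]
    simp only [add_sub_cancel_left, inner_add_left, inner_sub_left, inner_smul_left,
      inner_add_right, RCLike.conj_to_real]
    have := mul_nonneg ht0 (sub_nonneg.2 hs')
    rw [hxn] at this ⊢
    nlinarith
  have hsplit : ((4 * s) • (y + u) + (8 : ℝ) • (‖A‖ ^ 2 • (y + u) - ⟪A, y + u⟫ • A)) -
      ((4 * t) • y + (8 : ℝ) • (‖A‖ ^ 2 • y - ⟪A, y⟫ • A)) =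
      (4 * (s - t)) • (y + u) + (4 * t) • u + (8 : ℝ) • (‖A‖ ^ 2 • u - ⟪A, u⟫ • A) := by
    rw [inner_add_right]
    module
  have hq : ‖(8 : ℝ) • (‖A‖ ^ 2 • u - ⟪A, u⟫ • A)‖ ^ 2 =
      64 * ‖A‖ ^ 2 * (‖A‖ ^ 2 * ‖u‖ ^ 2 - ⟪A, u⟫ ^ 2) := by
    rw [norm_smul, mul_pow, norm_sub_sq_real, norm_smul, norm_smul, inner_smul_left,
      inner_smul_right, real_inner_comm]
    simp only [RCLike.conj_to_real, Real.norm_eq_abs, mul_pow, sq_abs]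
    ring
  have h3 (a b c : E) : ‖a + b + c‖ ^ 2 ≤ 3 * (‖a‖ ^ 2 + ‖b‖ ^ 2 + ‖c‖ ^ 2) := by
    have := norm_add₃_le (a := a) (b := b) (c := c)
    nlinarith [norm_nonneg (a + b + c), sq_nonneg (‖a‖ - ‖b‖), sq_nonneg (‖b‖ - ‖c‖),
      sq_nonneg (‖a‖ - ‖c‖)]
  rw [hsplit]
  refine (h3 _ _ _).trans ?_
  rw [hq, norm_smul, norm_smul, mul_pow, mul_pow, Real.norm_eq_abs, Real.norm_eq_abs, sq_abs,
    sq_abs]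
  generalize ‖A‖ ^ 2 * ‖u‖ ^ 2 - ⟪A, u⟫ ^ 2 = Q at *
  have hX := sq_nonneg ‖y + u‖
  have hY := sq_nonneg ‖y‖
  have hA := sq_nonneg ‖A‖
  have hT : 0 ≤ t * ‖u‖ ^ 2 := by positivity
  have hS := sq_nonneg (s - t)
  have h1 : (s - t) ^ 2 ≤ D := by linarith
  have h2 : 2 * (t * ‖u‖ ^ 2) ≤ D := by linarith
  have h4 : 4 * Q ≤ D := by linarith
  have h5 := mul_le_mul_of_nonneg_right hty hT
  nlinarith [mul_le_mul_of_nonneg_left h1 hX, mul_le_mul_of_nonneg_left h2 hY,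
    mul_le_mul_of_nonneg_left h4 hA, mul_nonneg hY (hS.trans h1)]

end

/-- Stress convexity control for the relaxed two-well energy density. -/
theorem twoWell_stress_control
    (n : ℕ) (hn : 1 ≤ n) (F₁ F₂ : EuclideanSpace ℝ (Fin n)) (hF : F₁ ≠ F₂)
    (A B : EuclideanSpace ℝ (Fin n))
    (hA : A = (1 / 2 : ℝ) • (F₂ - F₁)) (hB : B = (1 / 2 : ℝ) • (F₁ + F₂))
    (W : EuclideanSpace ℝ (Fin n) → ℝ)
    (hW : ∀ F, W F = max 0 (‖F - B‖ ^ 2 - ‖A‖ ^ 2) ^ 2 +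
      4 * (‖A‖ ^ 2 * ‖F - B‖ ^ 2 - ⟪A, F - B⟫ ^ 2))
    (hWdiff : Differentiable ℝ W) :
    ∃ C : ℝ, 0 < C ∧ ∀ F G : EuclideanSpace ℝ (Fin n),
      ‖gradient W F - gradient W G‖ ^ 2 ≤
        C * (1 + ‖F‖ ^ 2 + ‖G‖ ^ 2) *
          (W F - W G - ⟪gradient W G, F - G⟫) := by
  refine ⟨48 * (2 + 4 * ‖B‖ ^ 2 + ‖A‖ ^ 2), by positivity, fun F G => ?_⟩
  obtain rfl := funext hW
  rw [(hasGradientAt_twoWell A B F).gradient, (hasGradientAt_twoWell A B G).gradient]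
  have key := twoWell_stress_sq_le A (F - B) (G - B)
  rw [sub_sub_sub_cancel_right] at key
  have hsq (H : EuclideanSpace ℝ (Fin n)) : ‖H - B‖ ^ 2 ≤ 2 * (‖H‖ ^ 2 + ‖B‖ ^ 2) := by
    nlinarith [norm_sub_le H B, norm_nonneg (H - B), sq_nonneg (‖H‖ - ‖B‖)]
  have hA0 : A ≠ 0 := by
    rw [hA]
    exact smul_ne_zero (by norm_num) (sub_ne_zero.2 hF.symm)
  have h0 : 0 < 48 * (‖F - B‖ ^ 2 + ‖G - B‖ ^ 2 + ‖A‖ ^ 2) := by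
    have := norm_pos_iff.2 hA0
    positivity
  refine key.trans (mul_le_mul_of_nonneg_right ?_
    (nonneg_of_mul_nonneg_right ((sq_nonneg _).trans key) h0))
  nlinarith [hsq F, hsq G, mul_nonneg (sq_nonneg ‖B‖) (sq_nonneg ‖F‖),
    mul_nonneg (sq_nonneg ‖B‖) (sq_nonneg ‖G‖), mul_nonneg (sq_nonneg ‖A‖) (sq_nonneg ‖F‖),
    mul_nonneg (sq_nonneg ‖A‖) (sq_nonneg ‖G‖)]
end

section
/- Let E be a finite-dimensional real inner product space and W : E → ℝ a differentiable function which satisfies a stress convexity control: there are constants C > 0, r̃ > 0 and s̃ ≥ 0 such that ‖∇W(A) − ∇W(B)‖^{r̃} ≤ C (1 + ‖A‖^{s̃} + ‖B‖^{s̃})(W(A) − W(B) − ⟨∇W(B), A − B⟩) for all A, B ∈ E. If A, B ∈ E satisfy the midpoint equality W((A + B)/2) = (W(A) + W(B))/2, then ∇W(A) = ∇W((A+B)/2) = ∇W(B). -/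
open scoped RealInnerProductSpace

/-- If a power of a norm is bounded by a positive multiple of `d`, then `d` is
nonnegative. -/
theorem nonneg_of_norm_rpow_le_mul {E : Type*} [SeminormedAddCommGroup E] {x : E} {r k d : ℝ}
    (hk : 0 < k) (h : ‖x‖ ^ r ≤ k * d) : 0 ≤ d :=
  nonneg_of_mul_nonneg_right ((Real.rpow_nonneg (norm_nonneg x) r).trans h) hk

/-- A vector whose norm has a nonpositive power, with nonzero exponent, is zero. -/
theorem eq_zero_of_norm_rpow_nonpos {E : Type*} [NormedAddCommGroup E] {x : E} {r : ℝ}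
    (hr : r ≠ 0) (h : ‖x‖ ^ r ≤ 0) : x = 0 :=
  norm_eq_zero.mp <| (Real.rpow_eq_zero (norm_nonneg x) hr).mp <|
    h.antisymm (Real.rpow_nonneg (norm_nonneg x) r)

/-- Stress convexity control implies that midpoint equality forces equality of the
gradients at the two points and at their midpoint. -/
theorem gradient_eq_of_stress_convexity_control
    {E : Type*} [NormedAddCommGroup E] [InnerProductSpace ℝ E] [FiniteDimensional ℝ E]
    (W : E → ℝ) (hWdiff : Differentiable ℝ W)
    (C r' s' : ℝ) (hC : 0 < C) (hr' : 0 < r') (hs' : 0 ≤ s')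
    (hcc : ∀ A B : E, ‖gradient W A - gradient W B‖ ^ r' ≤
      C * (1 + ‖A‖ ^ s' + ‖B‖ ^ s') * (W A - W B - ⟪gradient W B, A - B⟫)) :
    ∀ A B : E, W ((1 / 2 : ℝ) • (A + B)) = (W A + W B) / 2 →
      gradient W A = gradient W ((1 / 2 : ℝ) • (A + B)) ∧
        gradient W ((1 / 2 : ℝ) • (A + B)) = gradient W B := by
  intro A B hAB
  set M : E := (1 / 2 : ℝ) • (A + B) with hM
  have hpos (X : E) : 0 < C * (1 + ‖X‖ ^ s' + ‖M‖ ^ s') := by positivity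
  have hA := hcc A M
  have hB := hcc B M
  have hA_nonneg := nonneg_of_norm_rpow_le_mul (hpos A) hA
  have hB_nonneg := nonneg_of_norm_rpow_le_mul (hpos B) hB
  have hinner : ⟪gradient W M, A - M⟫ + ⟪gradient W M, B - M⟫ = 0 := by
    rw [← inner_add_right, show A - M + (B - M) = 0 by rw [hM]; module, inner_zero_right]
  rw [show W A - W M - ⟪gradient W M, A - M⟫ = 0 by linarith, mul_zero] at hA
  rw [show W B - W M - ⟪gradient W M, B - M⟫ = 0 by linarith, mul_zero] at hB
  exact ⟨sub_eq_zero.mp (eq_zero_of_norm_rpow_nonpos hr'.ne' hA),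
    (sub_eq_zero.mp (eq_zero_of_norm_rpow_nonpos hr'.ne' hB)).symm⟩
end
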